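/- Let X be a finite (discrete) space on which the discrete group Γ acts, let ℓ be a proper length function on Γ⋉X, and suppose Γ⋉X has the rapid decay property with respect to ℓ and some p > 0. Then for every integer k > p the set L_1' = { f ∈ C_c(Γ⋉X) : L_ℓ^k(f) ≤ 1 and f(e,x) = 0 for all x ∈ X } is totally bounded in C_c(Γ⋉X) with respect to the reduced norm ‖·‖_red. -/

import Mathlib

open scoped ENNReal

noncomputable section

variable {Γ X : Type*} [Group Γ] [TopologicalSpace X] [MulAction Γ X]

/-- `f ∈ C_c(Γ ⋉ X)` : each `f g : X → ℂ` is continuous, and `f g ≡ 0` for all but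
finitely many `g ∈ Γ`. -/
def IsCc (f : Γ → X → ℂ) : Prop :=
  (∀ g : Γ, Continuous (f g)) ∧ {g : Γ | f g ≠ 0}.Finite

/-- Convolution: `(f ∗ ξ)(g, x) = Σ_{h ∈ Γ} f (g h⁻¹, h ⋅ x) ξ (h, x)`. -/
def convCc (f ξ : Γ → X → ℂ) : Γ → X → ℂ :=
  fun g x => ∑ᶠ h : Γ, f (g * h⁻¹) (h • x) * ξ h x

/-- Involution: `f^*(g, x) = conj (f (g⁻¹, g ⋅ x))`. -/
def starCc (f : Γ → X → ℂ) : Γ → X → ℂ :=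
  fun g x => (starRingEnd ℂ) (f g⁻¹ (g • x))

/-- Pointwise multiplication by the length function: `M_ℓ(f)(g,x) = ℓ(g,x) f(g,x)`. -/
def mulLen (ℓ : Γ → X → ℝ) (f : Γ → X → ℂ) : Γ → X → ℂ :=
  fun g x => (ℓ g x : ℂ) * f g x

/-- Iterated derivation: `Δ⁰(f)(ξ) = f ∗ ξ` and
`Δ^k(f)(ξ) = M_ℓ(Δ^{k-1}(f)(ξ)) − Δ^{k-1}(f)(M_ℓ(ξ))`. -/
def deltaIter (ℓ : Γ → X → ℝ) (f : Γ → X → ℂ) : ℕ → (Γ → X → ℂ) → Γ → X → ℂ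
  | 0, ξ => convCc f ξ
  | k + 1, ξ => mulLen ℓ (deltaIter ℓ f k ξ) - deltaIter ℓ f k (mulLen ℓ ξ)

/-- Hilbert-module norm: `‖ξ‖ = sup_{x ∈ X} (Σ_{g ∈ Γ} |ξ(g,x)|²)^{1/2}`. -/
def hnorm (ξ : Γ → X → ℂ) : ℝ :=
  ⨆ x : X, Real.sqrt (∑ᶠ g : Γ, ‖ξ g x‖ ^ 2)

/-- The I-norm `‖f‖_I`. -/
def normI (f : Γ → X → ℂ) : ℝ :=
  max (⨆ x : X, ∑ᶠ g : Γ, ‖f g x‖) (⨆ x : X, ∑ᶠ g : Γ, ‖f g⁻¹ (g • x)‖)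

/-- The `C(X)`-valued inner product: `⟨⟨ξ, η⟩⟩(x) = Σ_{g ∈ Γ} conj(ξ(g,x)) η(g,x)`. -/
def innerCc (ξ η : Γ → X → ℂ) (x : X) : ℂ :=
  ∑ᶠ g : Γ, (starRingEnd ℂ) (ξ g x) * η g x

/-- Reduced norm: `‖f‖_red = sup { ‖f ∗ ξ‖ : ξ ∈ C_c, ‖ξ‖ ≤ 1 }`. -/
def redNorm (f : Γ → X → ℂ) : ℝ :=
  sSup {r : ℝ | ∃ ξ : Γ → X → ℂ, IsCc ξ ∧ hnorm ξ ≤ 1 ∧ r = hnorm (convCc f ξ)}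

/-- The quasi-seminorm `L_ℓ^k(f) = sup { ‖Δ^k(f)(ξ)‖ : ξ ∈ C_c, ‖ξ‖ ≤ 1 }`. -/
def lipK (ℓ : Γ → X → ℝ) (k : ℕ) (f : Γ → X → ℂ) : ℝ :=
  sSup {r : ℝ | ∃ ξ : Γ → X → ℂ, IsCc ξ ∧ hnorm ξ ≤ 1 ∧ r = hnorm (deltaIter ℓ f k ξ)}

/-- `‖f‖_{2,p,s,ℓ}`. -/
def norm2s (ℓ : Γ → X → ℝ) (p : ℝ) (f : Γ → X → ℂ) : ℝ :=
  ⨆ x : X, Real.sqrt (∑ᶠ g : Γ, ‖f g x‖ ^ 2 * (1 + ℓ g x) ^ (2 * p))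

/-- `‖f‖_{2,p,r,ℓ}`. -/
def norm2r (ℓ : Γ → X → ℝ) (p : ℝ) (f : Γ → X → ℂ) : ℝ :=
  ⨆ x : X, Real.sqrt (∑ᶠ g : Γ, ‖f g⁻¹ (g • x)‖ ^ 2 * (1 + ℓ g x) ^ (2 * p))

/-- `‖f‖_{2,p,ℓ} = max (‖f‖_{2,p,s,ℓ}, ‖f‖_{2,p,r,ℓ})`. -/
def norm2 (ℓ : Γ → X → ℝ) (p : ℝ) (f : Γ → X → ℂ) : ℝ :=
  max (norm2s ℓ p f) (norm2r ℓ p f)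

/-- A length function on the transformation groupoid `Γ ⋉ X`. -/
def IsLength (ℓ : Γ → X → ℝ) : Prop :=
  (∀ g : Γ, Continuous (ℓ g)) ∧ (∀ (g : Γ) (x : X), 0 ≤ ℓ g x) ∧
    (∀ (g : Γ) (x : X), ℓ g x = 0 ↔ g = 1) ∧
    (∀ (g : Γ) (x : X), ℓ g⁻¹ (g • x) = ℓ g x) ∧
    (∀ (g h : Γ) (x : X), ℓ (g * h) x ≤ ℓ g (h • x) + ℓ h x)

/-- Properness: for every `R ≥ 0`, only finitely many non-identity `g` satisfy
`ℓ(g, x) ≤ R` for some `x`. -/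
def IsProperLen (ℓ : Γ → X → ℝ) : Prop :=
  ∀ R : ℝ, {g : Γ | g ≠ 1 ∧ ∃ x : X, ℓ g x ≤ R}.Finite

theorem sum_comp_le_finsum {ι α : Type*} {u : α → ℝ} (hu : ∀ a, 0 ≤ u a)
    (hfin : (Function.support u).Finite) (G : Finset ι) {φ : ι → α}
    (hφ : Function.Injective φ) : ∑ i ∈ G, u (φ i) ≤ ∑ᶠ a, u a := by
  classical
  rw [finsum_eq_sum_of_support_subset (s := hfin.toFinset ∪ G.image φ) u (by
    intro a ha; simp [Function.mem_support.mp ha])]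
  rw [← Finset.sum_image (f := u) (s := G) (g := φ) (fun a _ b _ h => hφ h)]
  exact Finset.sum_le_sum_of_subset_of_nonneg Finset.subset_union_right (fun a _ _ => hu a)

theorem finsum_le_card_mul_add {α : Type*} {a b : α → ℝ} (F : Finset α) {c δ : ℝ}
    (hδ : 0 ≤ δ) (ha : (Function.support a).Finite) (hb : (Function.support b).Finite)
    (hb0 : ∀ i, 0 ≤ b i) (hF : ∀ i ∈ F, a i ≤ c)
    (hF' : ∀ i, i ∉ F → a i ≤ δ * b i) :
    ∑ᶠ i, a i ≤ F.card * c + δ * ∑ᶠ i, b i := by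
  classical
  set S := ha.toFinset ∪ hb.toFinset ∪ F with hS
  rw [finsum_eq_sum_of_support_subset (s := S) a (by
      intro i hi; simp [hS, Function.mem_support.mp hi]),
    finsum_eq_sum_of_support_subset (s := S) b (by
      intro i hi; simp [hS, Function.mem_support.mp hi])]
  have h1 : ∑ i ∈ S, (if i ∈ F then c else 0) = F.card * c := by
    rw [← Finset.sum_filter, Finset.sum_const, nsmul_eq_mul]
    congr 3
    ext i
    simp only [hS, Finset.mem_filter, Finset.mem_union]
    tauto
  rw [← h1, Finset.mul_sum, ← Finset.sum_add_distrib]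
  refine Finset.sum_le_sum fun i _ => ?_
  have := mul_nonneg hδ (hb0 i)
  split_ifs with h
  · linarith [hF i h]
  · linarith [hF' i h]

theorem exists_forall_one_add_rpow_le {p δ : ℝ} {k : ℕ} (hp : 0 < p) (hk : p < k) (hδ : 0 < δ) :
    ∃ R : ℝ, ∀ t : ℝ, R < t → (1 + t) ^ (2 * p) ≤ δ * (t ^ k) ^ 2 := by
  have h := (tendsto_rpow_neg_atTop (show 0 < 2 * (k : ℝ) - 2 * p by linarith)).eventually_le_const
    (show 0 < δ / 2 ^ (2 * p) by positivity)
  obtain ⟨R, hR⟩ := Filter.eventually_atTop.mp h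
  refine ⟨max R 1, fun t ht => ?_⟩
  have ht1 : 1 < t := (le_max_right _ _).trans_lt ht
  have ht0 : 0 < t := by linarith
  have := hR t ((le_max_left _ _).trans ht.le)
  have e : t ^ (2 * (k : ℝ)) = (t ^ k) ^ 2 := by
    rw [← pow_mul, mul_comm k 2, ← Real.rpow_natCast]; push_cast; rfl
  calc (1 + t) ^ (2 * p) ≤ (2 * t) ^ (2 * p) :=
        Real.rpow_le_rpow (by linarith) (by linarith) (by linarith)
    _ = 2 ^ (2 * p) * t ^ (2 * p) := Real.mul_rpow (by norm_num) ht0.le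
    _ = 2 ^ (2 * p) * (t ^ (-(2 * (k : ℝ) - 2 * p)) * t ^ (2 * (k : ℝ))) := by
        rw [← Real.rpow_add ht0]; ring_nf
    _ ≤ 2 ^ (2 * p) * (δ / 2 ^ (2 * p) * t ^ (2 * (k : ℝ))) := by gcongr
    _ = δ * (t ^ k) ^ 2 := by rw [e]; field_simp

theorem support_apply_finite {G Y : Type*} {ξ : G → Y → ℂ} (hξ : {g : G | ξ g ≠ 0}.Finite) (x : Y) :
    {g : G | ξ g x ≠ 0}.Finite :=
  hξ.subset fun g hg h => hg (by rw [h]; rfl)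

theorem support_inv_apply_finite {G Y : Type*} [Group G] [MulAction G Y]
    {ξ : G → Y → ℂ} (hξ : {g : G | ξ g ≠ 0}.Finite) (x : Y) :
    {g : G | ξ g⁻¹ (g • x) ≠ 0}.Finite :=
  (hξ.preimage (f := fun g : G => g⁻¹) inv_injective.injOn).subset
    fun g hg h => hg (by rw [h]; rfl)

theorem deltaIter_apply {G Y : Type*} [Group G] [MulAction G Y]
    (ℓ : G → Y → ℝ) (f : G → Y → ℂ) (k : ℕ) {ξ : G → Y → ℂ}
    (hξ : {g : G | ξ g ≠ 0}.Finite) (g : G) (x : Y) :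
    deltaIter ℓ f k ξ g x =
      ∑ᶠ h : G, ((ℓ g x : ℂ) - ℓ h x) ^ k * f (g * h⁻¹) (h • x) * ξ h x := by
  induction k generalizing ξ with
  | zero => simp [deltaIter, convCc]
  | succ k ih =>
    have hm : {h : G | mulLen ℓ ξ h ≠ 0}.Finite := hξ.subset fun h hh h0 => hh (by
      ext y; simp [mulLen, show ξ h = 0 from h0])
    have hs (u : G → ℂ) : Function.support (fun h => u h * ξ h x) ⊆ (hξ.toFinset : Set G) := by
      intro h hh
      simp only [Set.Finite.coe_toFinset, Set.mem_ofPred_eq]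
      intro h0
      simp [h0] at hh
    have hs' : Function.support
        (fun h => ((ℓ g x : ℂ) - ℓ h x) ^ k * f (g * h⁻¹) (h • x) * mulLen ℓ ξ h x) ⊆
          (hξ.toFinset : Set G) := by
      refine subset_trans (fun h hh => ?_)
        (hs fun h => ((ℓ g x : ℂ) - ℓ h x) ^ k * f (g * h⁻¹) (h • x) * ℓ h x)
      simpa [mulLen, mul_assoc] using hh
    have := ih hm
    simp only [deltaIter, Pi.sub_apply]
    rw [this, mulLen, ih hξ, finsum_eq_sum_of_support_subset _ (hs _),
      finsum_eq_sum_of_support_subset _ (hs _), finsum_eq_sum_of_support_subset _ hs',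
      Finset.mul_sum, ← Finset.sum_sub_distrib]
    refine Finset.sum_congr rfl fun h _ => ?_
    simp only [mulLen]
    ring

theorem deltaIter_support_finite {G Y : Type*} [Group G] [MulAction G Y]
    (ℓ : G → Y → ℝ) {f : G → Y → ℂ} (k : ℕ) {ξ : G → Y → ℂ}
    (hf : {g : G | f g ≠ 0}.Finite) (hξ : {g : G | ξ g ≠ 0}.Finite) (x : Y) :
    {g : G | deltaIter ℓ f k ξ g x ≠ 0}.Finite := by
  refine (Set.Finite.image2 (fun a b => a * b) hf hξ).subset fun g hg => ?_
  simp only [Set.mem_ofPred_eq, deltaIter_apply ℓ f k hξ] at hg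
  obtain ⟨h, hh⟩ := not_forall.mp (mt finsum_eq_zero_of_forall_eq_zero hg)
  refine ⟨g * h⁻¹, fun h0 => hh ?_, h, fun h0 => hh ?_, by simp⟩
  · simp [h0]
  · simp [h0]

theorem abs_length_sub_le {ℓ : Γ → X → ℝ} (hℓ : IsLength ℓ) (g h : Γ) (x : X) :
    |ℓ g x - ℓ h x| ≤ ℓ (g * h⁻¹) (h • x) := by
  obtain ⟨-, -, -, hinv, htri⟩ := hℓ
  have h1 := htri (g * h⁻¹) h x
  have h2 := htri (h * g⁻¹) g x
  have h3 := hinv (g * h⁻¹) (h • x)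
  simp only [mul_inv_rev, inv_inv, smul_smul, inv_mul_cancel_right] at h1 h2 h3
  rw [abs_le]
  constructor <;> linarith

theorem exists_deltaIter_bound [Finite X] {ℓ : Γ → X → ℝ} (hℓ : IsLength ℓ) {f : Γ → X → ℂ}
    (hf : {g : Γ | f g ≠ 0}.Finite) (k : ℕ) :
    ∃ K : ℝ, 0 ≤ K ∧ ∀ ξ : Γ → X → ℂ, {g : Γ | ξ g ≠ 0}.Finite → ∀ x : X,
      ∑ᶠ g : Γ, ‖deltaIter ℓ f k ξ g x‖ ^ 2 ≤ K * ∑ᶠ g : Γ, ‖ξ g x‖ ^ 2 := by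
  classical
  obtain ⟨B, hB⟩ : ∃ B : ℝ, ∀ a ∈ hf.toFinset, ∀ y : X, ℓ a y ^ k * ‖f a y‖ ≤ B := by
    obtain ⟨B, hB⟩ := Set.Finite.bddAbove (Set.finite_range
      fun z : hf.toFinset × X => ℓ z.1 z.2 ^ k * ‖f z.1 z.2‖)
    exact ⟨B, fun a ha y => hB ⟨(⟨a, ha⟩, y), rfl⟩⟩
  set F := hf.toFinset with hF
  refine ⟨F.card * B ^ 2 * F.card, by positivity, fun ξ hξ x => ?_⟩
  have hfin : (Function.support fun g => ‖ξ g x‖ ^ 2).Finite :=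
    (support_apply_finite hξ x).subset fun g hg h0 => hg (by simp [h0])
  have hpt (g : Γ) : ‖deltaIter ℓ f k ξ g x‖ ^ 2 ≤
      F.card * B ^ 2 * ∑ a ∈ F, ‖ξ (a⁻¹ * g) x‖ ^ 2 := by
    have e : deltaIter ℓ f k ξ g x = ∑ a ∈ F, ((ℓ g x : ℂ) - ℓ (a⁻¹ * g) x) ^ k *
        f a ((a⁻¹ * g) • x) * ξ (a⁻¹ * g) x := by
      rw [deltaIter_apply ℓ f k hξ, finsum_eq_sum_of_support_subset
        (s := F.image fun a => a⁻¹ * g), Finset.sum_image]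
      · simp
      · intro a _ b _ h; simpa using h
      · intro h hh
        simp only [Finset.coe_image, Set.mem_image, Finset.mem_coe, hF, Set.Finite.mem_toFinset,
          Set.mem_ofPred_eq]
        exact ⟨g * h⁻¹, fun h0 => hh (by simp [h0]), by simp⟩
    have hle : ‖deltaIter ℓ f k ξ g x‖ ≤ ∑ a ∈ F, B * ‖ξ (a⁻¹ * g) x‖ := by
      rw [e]
      refine (norm_sum_le _ _).trans (Finset.sum_le_sum fun a ha => ?_)
      rw [norm_mul, norm_mul, norm_pow, ← Complex.ofReal_sub, Complex.norm_real, Real.norm_eq_abs]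
      refine mul_le_mul_of_nonneg_right (le_trans ?_ (hB a ha ((a⁻¹ * g) • x))) (norm_nonneg _)
      have := abs_length_sub_le hℓ g (a⁻¹ * g) x
      simp only [mul_inv_rev, inv_inv, mul_inv_cancel_left] at this
      gcongr
    calc ‖deltaIter ℓ f k ξ g x‖ ^ 2 ≤ (∑ a ∈ F, B * ‖ξ (a⁻¹ * g) x‖) ^ 2 := by gcongr
      _ ≤ F.card * ∑ a ∈ F, (B * ‖ξ (a⁻¹ * g) x‖) ^ 2 := sq_sum_le_card_mul_sum_sq
      _ = _ := by simp only [mul_pow, ← Finset.mul_sum]; ring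
  have hη : (Function.support fun g => ‖deltaIter ℓ f k ξ g x‖ ^ 2).Finite :=
    (deltaIter_support_finite ℓ k hf hξ x).subset fun g hg h0 => hg (by simp [h0])
  rw [finsum_eq_sum_of_support_subset (s := hη.toFinset) _ (by simp)]
  calc _ ≤ ∑ g ∈ hη.toFinset, F.card * B ^ 2 * ∑ a ∈ F, ‖ξ (a⁻¹ * g) x‖ ^ 2 :=
        Finset.sum_le_sum fun g _ => hpt g
    _ = F.card * B ^ 2 * ∑ a ∈ F, ∑ g ∈ hη.toFinset, ‖ξ (a⁻¹ * g) x‖ ^ 2 := by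
        rw [← Finset.mul_sum, Finset.sum_comm]
    _ ≤ F.card * B ^ 2 * ∑ _a ∈ F, ∑ᶠ g, ‖ξ g x‖ ^ 2 := by
        gcongr with a _
        exact sum_comp_le_finsum (u := fun g => ‖ξ g x‖ ^ 2) (fun _ => by positivity) hfin _
          (mul_right_injective a⁻¹)
    _ = _ := by rw [Finset.sum_const, nsmul_eq_mul]; ring

theorem finsum_sq_le_one_of_hnorm_le_one {G Y : Type*} [Finite Y] {ξ : G → Y → ℂ}
    (h : hnorm ξ ≤ 1) (x : Y) :
    ∑ᶠ g : G, ‖ξ g x‖ ^ 2 ≤ 1 := by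
  have := (le_ciSup (Set.finite_range fun x => Real.sqrt (∑ᶠ g : G, ‖ξ g x‖ ^ 2)).bddAbove
    x).trans h
  simpa using this

theorem hnorm_le_one {G Y : Type*} {ξ : G → Y → ℂ}
    (h : ∀ x, ∑ᶠ g : G, ‖ξ g x‖ ^ 2 ≤ 1) : hnorm ξ ≤ 1 :=
  Real.iSup_le (fun x => Real.sqrt_le_one.mpr (h x)) zero_le_one

theorem bddAbove_lipK [Finite X] {ℓ : Γ → X → ℝ} (hℓ : IsLength ℓ) {f : Γ → X → ℂ}
    (hf : IsCc f) (k : ℕ) :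
    BddAbove {r : ℝ | ∃ ξ : Γ → X → ℂ, IsCc ξ ∧ hnorm ξ ≤ 1 ∧ r = hnorm (deltaIter ℓ f k ξ)} := by
  obtain ⟨K, hK, hb⟩ := exists_deltaIter_bound hℓ hf.2 k
  refine ⟨Real.sqrt K, ?_⟩
  rintro _ ⟨ξ, hξ, h1, rfl⟩
  refine Real.iSup_le (fun x => Real.sqrt_le_sqrt ((hb ξ hξ.2 x).trans ?_)) (Real.sqrt_nonneg _)
  exact mul_le_of_le_one_right hK (finsum_sq_le_one_of_hnorm_le_one h1 x)

theorem finsum_deltaIter_sq_le_one [Finite X] {ℓ : Γ → X → ℝ} (hℓ : IsLength ℓ) {f : Γ → X → ℂ}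
    (hf : IsCc f) {k : ℕ} (hL : lipK ℓ k f ≤ 1) {ξ : Γ → X → ℂ} (hξ : IsCc ξ)
    (h1 : ∀ x, ∑ᶠ g : Γ, ‖ξ g x‖ ^ 2 ≤ 1) (x : X) :
    ∑ᶠ g : Γ, ‖deltaIter ℓ f k ξ g x‖ ^ 2 ≤ 1 :=
  finsum_sq_le_one_of_hnorm_le_one
    ((le_csSup (bddAbove_lipK hℓ hf k) ⟨ξ, hξ, hnorm_le_one h1, rfl⟩).trans hL) x

/-- The column of `Δ^k(f)` at the unit. -/
theorem finsum_source_le_one [Finite X] {ℓ : Γ → X → ℝ} (hℓ : IsLength ℓ) {f : Γ → X → ℂ}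
    (hf : IsCc f) {k : ℕ} (hL : lipK ℓ k f ≤ 1) (x : X) :
    ∑ᶠ g : Γ, (‖f g x‖ * ℓ g x ^ k) ^ 2 ≤ 1 := by
  classical
  set ξ : Γ → X → ℂ := fun g _ => if g = 1 then 1 else 0 with hξ
  have hξc : IsCc ξ := by
    refine ⟨fun g => continuous_const, (Set.finite_singleton (1 : Γ)).subset fun g hg => ?_⟩
    by_contra h
    exact hg (by ext y; simpa [hξ] using h)
  have h1 (y : X) : ∑ᶠ g : Γ, ‖ξ g y‖ ^ 2 ≤ 1 := by
    rw [finsum_eq_single _ 1 (by intro g hg; simp [hξ, hg])]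
    simp [hξ]
  have := finsum_deltaIter_sq_le_one hℓ hf hL hξc h1 x
  convert this using 4 with g
  rw [deltaIter_apply ℓ f k hξc.2, finsum_eq_single _ 1 (by intro g hg; simp [hξ, hg])]
  simp [hξ, (hℓ.2.2.1 1 x).mpr rfl, abs_of_nonneg (hℓ.2.1 g x), mul_comm]

/-- The row of `Δ^k(f)` at the unit. -/
theorem finsum_range_le_one [Finite X] [DiscreteTopology X] {ℓ : Γ → X → ℝ} (hℓ : IsLength ℓ)
    {f : Γ → X → ℂ} (hf : IsCc f) {k : ℕ} (hL : lipK ℓ k f ≤ 1) (x : X) :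
    ∑ᶠ g : Γ, (‖f g⁻¹ (g • x)‖ * ℓ g x ^ k) ^ 2 ≤ 1 := by
  classical
  set A : Γ → ℂ := fun h => (-(ℓ h x : ℂ)) ^ k * f h⁻¹ (h • x) with hA
  have hAn (h : Γ) : ‖A h‖ = ‖f h⁻¹ (h • x)‖ * ℓ h x ^ k := by
    simp [hA, abs_of_nonneg (hℓ.2.1 h x), mul_comm]
  simp only [← hAn]
  set S := ∑ᶠ g : Γ, ‖A g‖ ^ 2 with hS
  have hS0 : 0 ≤ S := finsum_nonneg fun _ => by positivity
  rcases hS0.eq_or_lt with h0 | hpos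
  · rw [← h0]; exact zero_le_one
  have hAfin : {h : Γ | A h ≠ 0}.Finite :=
    (support_inv_apply_finite hf.2 x).subset fun h hh h0 => hh (by simp [hA, h0])
  have hs : 0 < Real.sqrt S := Real.sqrt_pos.mpr hpos
  have hss : Real.sqrt S ^ 2 = S := Real.sq_sqrt hS0
  set ξ : Γ → X → ℂ :=
    fun h y => if y = x then (starRingEnd ℂ) (A h) / (Real.sqrt S : ℂ) else 0 with hξ
  have hξc : IsCc ξ := ⟨fun g => continuous_of_discreteTopology,
    hAfin.subset fun h hh h0 => hh (by ext y; simp [hξ, h0])⟩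
  have h1 (y : X) : ∑ᶠ g : Γ, ‖ξ g y‖ ^ 2 ≤ 1 := by
    by_cases hy : y = x
    · have : ∀ g, ‖ξ g y‖ ^ 2 = S⁻¹ * ‖A g‖ ^ 2 := by
        intro g
        simp only [hξ, hy, if_true, norm_div, RCLike.norm_conj, Complex.norm_real, div_pow,
          Real.norm_eq_abs, sq_abs, hss]
        ring
      simp only [this]
      rw [← mul_finsum, ← hS,
        inv_mul_cancel₀ hpos.ne']
    · simp [hξ, hy]
  have hb := finsum_deltaIter_sq_le_one hℓ hf hL hξc h1 x
  have hval : deltaIter ℓ f k ξ 1 x = (Real.sqrt S : ℂ) := by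
    have : ∀ h, ((ℓ 1 x : ℂ) - ℓ h x) ^ k * f (1 * h⁻¹) (h • x) * ξ h x =
        ((‖A h‖ ^ 2 / Real.sqrt S : ℝ) : ℂ) := by
      intro h
      simp only [(hℓ.2.2.1 1 x).mpr rfl, hξ, if_true, one_mul, Complex.ofReal_zero, zero_sub]
      rw [← mul_div_assoc, show (-(ℓ h x : ℂ)) ^ k * f h⁻¹ (h • x) = A h from rfl,
        Complex.mul_conj, Complex.normSq_eq_norm_sq]
      push_cast; rfl
    rw [deltaIter_apply ℓ f k hξc.2]
    simp only [this]
    have hsub : (Function.support fun h => ‖A h‖ ^ 2) ⊆ (hAfin.toFinset : Set Γ) := by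
      intro h hh
      simpa using hh
    rw [finsum_eq_sum_of_support_subset (s := hAfin.toFinset) _ (by
      intro h hh
      simp only [Function.mem_support] at hh
      simp only [Set.Finite.coe_toFinset, Set.mem_ofPred_eq]
      intro h0
      simp [h0] at hh), ← Complex.ofReal_sum, ← Finset.sum_div,
      ← finsum_eq_sum_of_support_subset _ hsub, ← hS]
    congr 1
    rw [div_eq_iff hs.ne', ← sq, hss]
  have hle := single_le_finsum (f := fun g => ‖deltaIter ℓ f k ξ g x‖ ^ 2) 1
    ((deltaIter_support_finite ℓ k hf.2 hξc.2 x).subset fun g hg h0 => hg (by simp [h0]))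
    (fun _ => by positivity)
  simp only [hval, Complex.norm_real, Real.norm_eq_abs, sq_abs, hss] at hle
  exact hle.trans hb

theorem support_sq_mul_finite {G : Type*} {u : G → ℂ} (hu : {g : G | u g ≠ 0}.Finite) (w : G → ℝ) :
    (Function.support fun g => ‖u g‖ ^ 2 * w g).Finite :=
  hu.subset fun g hg h0 => hg (by simp [h0])

theorem support_mul_sq_finite {G : Type*} {u : G → ℂ} (hu : {g : G | u g ≠ 0}.Finite) (w : G → ℝ) :
    (Function.support fun g => (‖u g‖ * w g) ^ 2).Finite :=
  hu.subset fun g hg h0 => hg (by simp [h0])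

/-- if `X` is finite (discrete) and `Γ ⋉ X` has rapid decay with respect
to the proper length function `ℓ` and `p > 0`, then for every integer `k > p` the set
`L₁' = { f ∈ C_c : L_ℓ^k(f) ≤ 1, f|_X ≡ 0 }` is totally bounded for `‖·‖_red`. -/
theorem stmt_15 [Finite X] [DiscreteTopology X]
    (ℓ : Γ → X → ℝ) (hℓ : IsLength ℓ) (hprop : IsProperLen ℓ)
    (p C : ℝ) (hp : 0 < p) (hC : 0 < C)
    (hRD : ∀ f : Γ → X → ℂ, IsCc f → redNorm f ≤ C * norm2 ℓ p f)
    (k : ℕ) (hk : p < (k : ℝ)) :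
    ∀ ε : ℝ, 0 < ε → ∃ T : Finset (Γ → X → ℂ),
      ∀ f : Γ → X → ℂ, IsCc f → lipK ℓ k f ≤ 1 → (∀ x : X, f 1 x = 0) →
        ∃ t ∈ T, redNorm (f - t) < ε := by
  classical
  intro ε hε
  have hXF : Fintype X := Fintype.ofFinite X
  set e := ε / (2 * C) with he
  have hepos : 0 < e := by positivity
  obtain ⟨R, hR⟩ := exists_forall_one_add_rpow_le hp hk (show 0 < e ^ 2 / 2 by positivity)
  set F : Finset Γ := (hprop R).toFinset with hF
  have hmem (g : Γ) : g ∈ F ↔ g ≠ 1 ∧ ∃ x : X, ℓ g x ≤ R := by simp [hF]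
  have hinv (g : Γ) (hg : g ∈ F) : g⁻¹ ∈ F := by
    obtain ⟨h1, x, hx⟩ := (hmem g).mp hg
    exact (hmem _).mpr ⟨by simpa using h1, g • x, by rwa [hℓ.2.2.2.1]⟩
  obtain ⟨K, hK⟩ : ∃ K : ℝ, ∀ g ∈ F, ∀ y : X, (1 + ℓ g y) ^ (2 * p) ≤ K := by
    obtain ⟨B, hB⟩ := Set.Finite.bddAbove (Set.finite_range
      fun z : F × X => (1 + ℓ z.1 z.2) ^ (2 * p))
    exact ⟨B, fun a ha y => hB ⟨(⟨a, ha⟩, y), rfl⟩⟩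
  obtain ⟨M, hM⟩ : ∃ M : ℝ, ∀ g ∈ F, ∀ y : X, 1 / ℓ g y ^ k ≤ M := by
    obtain ⟨B, hB⟩ := Set.Finite.bddAbove (Set.finite_range
      fun z : F × X => 1 / ℓ z.1 z.2 ^ k)
    exact ⟨B, fun a ha y => hB ⟨(⟨a, ha⟩, y), rfl⟩⟩
  set D := F.card * |K| + 1 with hD
  have hDpos : 0 < D := by positivity
  set η := e / Real.sqrt (2 * D) with hη
  have hηpos : 0 < η := by positivity
  have hηsq : η ^ 2 * D = e ^ 2 / 2 := by
    rw [hη, div_pow, Real.sq_sqrt (by positivity)]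
    field_simp
  obtain ⟨N, -, hNfin, hN⟩ := finite_cover_balls_of_compact
    (isCompact_closedBall (0 : F → X → ℂ) |M|) hηpos
  let ext : (F → X → ℂ) → Γ → X → ℂ := fun v g x => if h : g ∈ F then v ⟨g, h⟩ x else 0
  refine ⟨hNfin.toFinset.image ext, fun f hf hL hf1 => ?_⟩
  have hsrc := finsum_source_le_one hℓ hf hL
  have hrng := finsum_range_le_one hℓ hf hL
  have hcoord : (fun (g : F) (x : X) => f g x) ∈ Metric.closedBall (0 : F → X → ℂ) |M| := by
    rw [mem_closedBall_zero_iff, pi_norm_le_iff_of_nonneg (abs_nonneg M)]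
    intro g
    rw [pi_norm_le_iff_of_nonneg (abs_nonneg M)]
    intro x
    have h1 := (single_le_finsum (f := fun g => (‖f g x‖ * ℓ g x ^ k) ^ 2) (g : Γ)
      (support_mul_sq_finite (support_apply_finite hf.2 x) _)
      (fun _ => by positivity)).trans (hsrc x)
    have hpos : 0 < ℓ g x := lt_of_le_of_ne (hℓ.2.1 _ _)
      fun h => ((hmem g).mp g.2).1 ((hℓ.2.2.1 _ _).mp h.symm)
    have h2 : ‖f g x‖ * ℓ g x ^ k ≤ 1 := by
      exact (sq_le_one_iff₀ (mul_nonneg (norm_nonneg _) (pow_nonneg hpos.le k))).mp h1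
    exact ((le_div_iff₀ (by positivity)).mpr h2).trans ((hM g g.2 x).trans (le_abs_self M))
  obtain ⟨v, hvN, hv⟩ := Set.mem_iUnion₂.mp (hN hcoord)
  have hclose (g : Γ) (hg : g ∈ F) (y : X) : ‖(f - ext v) g y‖ ≤ η := by
    rw [mem_ball_iff_norm] at hv
    have := ((norm_le_pi_norm (((fun (g : F) (x : X) => f g x) - v) ⟨g, hg⟩) y).trans
      (norm_le_pi_norm _ (⟨g, hg⟩ : F))).trans hv.le
    simpa [ext, hg] using this
  have hout (g : Γ) (hg : g ∉ F) (y : X) : (f - ext v) g y = f g y := by simp [ext, hg]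
  have hcc : IsCc (f - ext v) := by
    refine ⟨fun g => continuous_of_discreteTopology, (hf.2.union F.finite_toSet).subset ?_⟩
    intro g hg
    by_contra h
    simp only [Set.mem_union, Set.mem_ofPred_eq, Finset.mem_coe, not_or, not_not] at h
    exact hg (by ext y; rw [hout g h.2, h.1])
  have hwt (g : Γ) (hg : g ∉ F) (h1 : g ≠ 1) (x : X) :
      (1 + ℓ g x) ^ (2 * p) ≤ e ^ 2 / 2 * (ℓ g x ^ k) ^ 2 := by
    refine hR _ (lt_of_not_ge fun h => hg ((hmem g).mpr ⟨h1, x, h⟩))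
  have hw0 (g : Γ) (x : X) : 0 ≤ (1 + ℓ g x) ^ (2 * p) :=
    Real.rpow_nonneg (by linarith [hℓ.2.1 g x]) _
  have hin (g : Γ) (hg : g ∈ F) (x : X) {z : ℂ} (hz : ‖z‖ ≤ η) :
      ‖z‖ ^ 2 * (1 + ℓ g x) ^ (2 * p) ≤ η ^ 2 * |K| :=
    mul_le_mul (by gcongr) ((hK g hg x).trans (le_abs_self K)) (hw0 g x) (by positivity)
  have htail (g : Γ) (hg : g ∉ F) (x : X) {z : ℂ} (hz : g = 1 → z = 0) :
      ‖z‖ ^ 2 * (1 + ℓ g x) ^ (2 * p) ≤ e ^ 2 / 2 * (‖z‖ * ℓ g x ^ k) ^ 2 := by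
    by_cases h1 : g = 1
    · simp [hz h1]
    · calc _ ≤ ‖z‖ ^ 2 * (e ^ 2 / 2 * (ℓ g x ^ k) ^ 2) := by gcongr; exact hwt g hg h1 x
        _ = _ := by ring
  have hfinal {s b : ℝ} (hs : s ≤ F.card * (η ^ 2 * |K|) + e ^ 2 / 2 * b) (hb : b ≤ 1) :
      Real.sqrt s ≤ e := by
    rw [Real.sqrt_le_left hepos.le]
    have : e ^ 2 / 2 * b ≤ e ^ 2 / 2 := mul_le_of_le_one_right (by positivity) hb
    have h2 : F.card * (η ^ 2 * |K|) ≤ e ^ 2 / 2 := by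
      rw [← hηsq, hD]; nlinarith [sq_nonneg η]
    linarith
  have hnorm2 : norm2 ℓ p (f - ext v) ≤ e := by
    refine max_le (Real.iSup_le (fun x => ?_) hepos.le) (Real.iSup_le (fun x => ?_) hepos.le)
    · refine hfinal (finsum_le_card_mul_add F (by positivity)
        (support_sq_mul_finite (support_apply_finite hcc.2 x) _)
        (support_mul_sq_finite (support_apply_finite hf.2 x) _) (fun _ => by positivity)
        (fun g hg => hin g hg x (hclose g hg x)) fun g hg => ?_) (hsrc x)
      rw [hout g hg]
      exact htail g hg x fun h => by rw [h, hf1]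
    · refine hfinal (finsum_le_card_mul_add F (by positivity)
        (support_sq_mul_finite (support_inv_apply_finite hcc.2 x) _)
        (support_mul_sq_finite (support_inv_apply_finite hf.2 x) _) (fun _ => by positivity)
        (fun g hg => hin g hg x (hclose _ (hinv g hg) _)) fun g hg => ?_) (hrng x)
      rw [hout _ fun h => hg (inv_inv g ▸ hinv _ h)]
      exact htail g hg x fun h => by rw [h, inv_one, hf1]
  refine ⟨ext v, Finset.mem_image_of_mem _ (hNfin.mem_toFinset.mpr hvN), ?_⟩
  calc redNorm (f - ext v) ≤ C * norm2 ℓ p (f - ext v) := hRD _ hcc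
    _ ≤ C * e := by gcongr
    _ = ε / 2 := by rw [he]; field_simp
    _ < ε := by linarith
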